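/- For every real ε > 0 there exist δ > 0 and n₀ such that the following holds for all n ≥ n₀. If G is a simple graph on n vertices with independence number at most 2 and t₄(G) ≤ (3/25 + δ)·C(n,4), then: (i) the number of 5-element vertex subsets of G inducing a copy of the graph G₅ is at most ε·n⁵, where G₅ is the 5-vertex graph on {1,...,5} with edge set {13,15,24,25,34,35,45} (the complement of the disjoint union of a 4-vertex path and an isolated vertex); (ii) the number of 4-element vertex subsets of G inducing a 4-cycle C₄ is at most ε·n⁴; (iii) all but at most ε·n vertices v of G satisfy |deg(v) − 3n/5| ≤ ε·n. -/

import Mathlib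

/-- `G` has no independent set with more than `m` vertices, i.e. α(G) ≤ m. -/
def IndepBound {V : Type*} (G : SimpleGraph V) (m : ℕ) : Prop :=
  ∀ s : Finset V, (∀ u ∈ s, ∀ v ∈ s, u ≠ v → ¬ G.Adj u v) → s.card ≤ m

/-- the number of `k`-cliques of `G`. -/
noncomputable def cliqueCount {V : Type*} [Fintype V] (G : SimpleGraph V) (k : ℕ) : ℕ :=
  Nat.card {s : Finset V // s.card = k ∧ G.IsClique (s : Set V)}

/-- the number of vertex subsets of `G` whose induced subgraph is isomorphic to `H`. -/
noncomputable def copyCount {V W : Type*} [Fintype V] [Fintype W]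
    (H : SimpleGraph W) (G : SimpleGraph V) : ℕ :=
  Nat.card {s : Finset V // Nonempty (H ≃g G.induce (s : Set V))}

/-- the degree of the vertex `v` in `G`. -/
noncomputable def degCount {V : Type*} (G : SimpleGraph V) (v : V) : ℕ :=
  {u | G.Adj v u}.ncard

/-- The 5-vertex graph G₅ on {1,…,5} with edges {13,15,24,25,34,35,45}
(here on {0,…,4} with edges {02,04,13,14,23,24,34}). -/
def graphG5 : SimpleGraph (Fin 5) :=
  SimpleGraph.fromRel (fun a b =>
    ((a, b) : Fin 5 × Fin 5) ∈
      [((0 : Fin 5), (2 : Fin 5)), (0, 4), (1, 3), (1, 4), (2, 3), (2, 4), (3, 4)])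

/-- The 4-cycle C₄. -/
def cycle4 : SimpleGraph (Fin 4) :=
  SimpleGraph.fromRel (fun a b => b = a + 1)

/-- A five-element type; a plain enumeration, as it keeps kernel evaluation cheap. -/
inductive Five
  | v0 | v1 | v2 | v3 | v4
  deriving DecidableEq

instance : Fintype Five := ⟨{.v0, .v1, .v2, .v3, .v4}, fun x => by cases x <;> decide⟩

/-- Indicator that `a, b, c, d` are pairwise unrelated by `r`. -/
def indepInd {V : Type*} (r : V → V → Bool) (a b c d : V) : ℤ :=
  bif r a b || r a c || r a d || r b c || r b d || r c d then 0 else 1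

/-- `1` if `y` has exactly one neighbour among `a, b, c`, `-1` if exactly two, else `0`. -/
def emptyForm {V : Type*} (r : V → V → Bool) (a b c y : V) : ℤ :=
  bif r a y then
    (bif r b y then (bif r c y then 0 else -1) else (bif r c y then -1 else 1))
  else (bif r b y then (bif r c y then -1 else 1) else (bif r c y then 1 else 0))

/-- `1` if `y` is adjacent to `c` and to `a` or `b`, `-2` if `y` is adjacent to none of them,
else `0`. -/
def edgeForm {V : Type*} (r : V → V → Bool) (a b c y : V) : ℤ :=
  bif r a y || r b y then (bif r c y then 1 else 0) else (bif r c y then 0 else -2)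

/-- The difference of the adjacencies of `y` to `a` and to `b`. -/
def diffForm {V : Type*} (r : V → V → Bool) (a b y : V) : ℤ := (r a y).toInt - (r b y).toInt

/-- The centred number of neighbours of `v` among `y, z`. -/
def degForm {V : Type*} (r : V → V → Bool) (v y z : V) : ℤ :=
  5 * ((r v y).toInt + (r v z).toInt) - 4

/-- The centred indicator of `yz` being the only related pair among `v, y, z`. -/
def coedgeForm {V : Type*} (r : V → V → Bool) (v y z : V) : ℤ :=
  (bif r y z && !r v y && !r v z then 25 else 0) - 2

/-- The centred indicator of `v` being adjacent to both `y` and `z`. -/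
def cherryForm {V : Type*} (r : V → V → Bool) (v y z : V) : ℤ :=
  (bif r v y && r v z then 25 else 0) - 4

/-- The polarization of a positive definite ternary quadratic form. -/
def bilin (e p q x y z : ℤ) : ℤ :=
  e * (350 * x + 15 * y - 155 * z) + p * (15 * x + 6 * y + z)
    + q * (-155 * x + y + 80 * z)

/-- The term of the certificate based at an independent triple `a, b, c`. -/
def emptyTerm {V : Type*} (r : V → V → Bool) (a b c y z : V) : ℤ :=
  bif r a b || r a c || r b c then 0 else emptyForm r a b c y * emptyForm r a b c z

/-- The terms of the certificate based at a triple `a, b, c` spanning just the edge `ab`, or a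
path with centre `c`. -/
def edgePathTerm {V : Type*} (r : V → V → Bool) (a b c y z : V) : ℤ :=
  bif r a b then
    (bif r a c || r b c then 0 else
      625 * (edgeForm r a b c y * edgeForm r a b c z)
        + 10625 * (diffForm r a b y * diffForm r a b z))
  else (bif r a c && r b c then 625 * (diffForm r a b y * diffForm r a b z) else 0)

/-- The term of the certificate based at a vertex `v`. -/
def vertexTerm {V : Type*} (r : V → V → Bool) (v y z u w : V) : ℤ :=
  bilin (degForm r v y z) (coedgeForm r v y z) (cherryForm r v y z)
    (degForm r v u w) (coedgeForm r v u w) (cherryForm r v u w)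

/-- One ordering of five elements for each omitted element, placed last. -/
def omitOne : List (Five × Five × Five × Five × Five) :=
  [(.v1, .v2, .v3, .v4, .v0), (.v0, .v2, .v3, .v4, .v1), (.v0, .v1, .v3, .v4, .v2),
   (.v0, .v1, .v2, .v4, .v3), (.v0, .v1, .v2, .v3, .v4)]

/-- One ordering of five elements for each pair, placed last. -/
def omitPair : List (Five × Five × Five × Five × Five) :=
  [(.v2, .v3, .v4, .v0, .v1), (.v1, .v3, .v4, .v0, .v2), (.v1, .v2, .v4, .v0, .v3),
   (.v1, .v2, .v3, .v0, .v4), (.v0, .v3, .v4, .v1, .v2), (.v0, .v2, .v4, .v1, .v3),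
   (.v0, .v2, .v3, .v1, .v4), (.v0, .v1, .v4, .v2, .v3), (.v0, .v1, .v3, .v2, .v4),
   (.v0, .v1, .v2, .v3, .v4)]

/-- One ordering of five elements for each partition into a pair, a singleton and a pair. -/
def pairSinglePair : List (Five × Five × Five × Five × Five) :=
  [(.v3, .v4, .v2, .v0, .v1), (.v2, .v4, .v3, .v0, .v1), (.v2, .v3, .v4, .v0, .v1),
   (.v3, .v4, .v1, .v0, .v2), (.v1, .v4, .v3, .v0, .v2), (.v1, .v3, .v4, .v0, .v2),
   (.v2, .v4, .v1, .v0, .v3), (.v1, .v4, .v2, .v0, .v3), (.v1, .v2, .v4, .v0, .v3),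
   (.v2, .v3, .v1, .v0, .v4), (.v1, .v3, .v2, .v0, .v4), (.v1, .v2, .v3, .v0, .v4),
   (.v3, .v4, .v0, .v1, .v2), (.v0, .v4, .v3, .v1, .v2), (.v0, .v3, .v4, .v1, .v2),
   (.v2, .v4, .v0, .v1, .v3), (.v0, .v4, .v2, .v1, .v3), (.v0, .v2, .v4, .v1, .v3),
   (.v2, .v3, .v0, .v1, .v4), (.v0, .v3, .v2, .v1, .v4), (.v0, .v2, .v3, .v1, .v4),
   (.v1, .v4, .v0, .v2, .v3), (.v0, .v4, .v1, .v2, .v3), (.v0, .v1, .v4, .v2, .v3),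
   (.v1, .v3, .v0, .v2, .v4), (.v0, .v3, .v1, .v2, .v4), (.v0, .v1, .v3, .v2, .v4),
   (.v1, .v2, .v0, .v3, .v4), (.v0, .v2, .v1, .v3, .v4), (.v0, .v1, .v2, .v3, .v4)]

/-- One ordering of five elements for each singleton with a matching of the other four. -/
def singleMatching : List (Five × Five × Five × Five × Five) :=
  [(.v0, .v1, .v2, .v3, .v4), (.v0, .v1, .v3, .v2, .v4), (.v0, .v1, .v4, .v2, .v3),
   (.v1, .v0, .v2, .v3, .v4), (.v1, .v0, .v3, .v2, .v4), (.v1, .v0, .v4, .v2, .v3),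
   (.v2, .v0, .v1, .v3, .v4), (.v2, .v0, .v3, .v1, .v4), (.v2, .v0, .v4, .v1, .v3),
   (.v3, .v0, .v1, .v2, .v4), (.v3, .v0, .v2, .v1, .v4), (.v3, .v0, .v4, .v1, .v2),
   (.v4, .v0, .v1, .v2, .v3), (.v4, .v0, .v2, .v1, .v3), (.v4, .v0, .v3, .v1, .v2)]

/-- The sum of `g` over a list of orderings of five elements. -/
def orderSum (L : List (Five × Five × Five × Five × Five))
    (g : Five → Five → Five → Five → Five → ℤ) : ℤ :=
  (L.map fun (i, j, k, l, m) => g i j k l m).sum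

/-- The symmetrized certificate on five vertices. -/
def certificate (a : Five → Five → Bool) : ℤ :=
  7500 * orderSum omitOne (fun i j k l _ => indepInd a i j k l) - 4500
    - 1250 * orderSum omitPair (emptyTerm a)
    - orderSum pairSinglePair (edgePathTerm a)
    - orderSum singleMatching (vertexTerm a)

/-- Indicator that `0123` is an induced path and `4` is isolated. -/
def pathPointInd (a : Five → Five → Bool) : ℤ :=
  bif a .v0 .v1 && a .v1 .v2 && a .v2 .v3 && !a .v0 .v2 && !a .v0 .v3 && !a .v1 .v3
    && !a .v0 .v4 && !a .v1 .v4 && !a .v2 .v4 && !a .v3 .v4 then 1 else 0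

/-- Indicator that `01` and `23` are the only related pairs among `0, 1, 2, 3`. -/
def matchingInd (a : Five → Five → Bool) : ℤ :=
  bif a .v0 .v1 && a .v2 .v3 && !a .v0 .v2 && !a .v0 .v3 && !a .v1 .v2 && !a .v1 .v3 then 1 else 0

/-- The symmetric irreflexive Boolean matrix with the given entries above the diagonal. -/
def symmMatrix (b01 b02 b12 b03 b13 b23 b04 b14 b24 b34 : Bool) : Five → Five → Bool :=
  fun
  | .v0 => fun | .v0 => false | .v1 => b01 | .v2 => b02 | .v3 => b03 | .v4 => b04
  | .v1 => fun | .v0 => b01 | .v1 => false | .v2 => b12 | .v3 => b13 | .v4 => b14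
  | .v2 => fun | .v0 => b02 | .v1 => b12 | .v2 => false | .v3 => b23 | .v4 => b24
  | .v3 => fun | .v0 => b03 | .v1 => b13 | .v2 => b23 | .v3 => false | .v4 => b34
  | .v4 => fun | .v0 => b04 | .v1 => b14 | .v2 => b24 | .v3 => b34 | .v4 => false

/-- The certificate inequality for all triangle-free graphs on five labelled vertices. -/
theorem certificate_symmMatrix : ∀ b01 b02 b12 : Bool, (b01 && b02 && b12) = false →
    ∀ b03 b13 b23 : Bool, (b01 && b03 && b13 || b02 && b03 && b23 || b12 && b13 && b23) = false →
    ∀ b04 b14 b24 b34 : Bool, (b01 && b04 && b14 || b02 && b04 && b24 || b12 && b14 && b24 ||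
      b03 && b04 && b34 || b13 && b14 && b34 || b23 && b24 && b34) = false →
    0 ≤ certificate (symmMatrix b01 b02 b12 b03 b13 b23 b04 b14 b24 b34) -
      625 * (pathPointInd (symmMatrix b01 b02 b12 b03 b13 b23 b04 b14 b24 b34)
        + matchingInd (symmMatrix b01 b02 b12 b03 b13 b23 b04 b14 b24 b34)) := by
  decide +kernel

theorem le_certificate (a : Five → Five → Bool) (hs : ∀ i j, a i j = a j i)
    (hi : ∀ i, a i i = false) (ht : ∀ i j k, (a i j && a i k && a j k) = false) :
    625 * (pathPointInd a + matchingInd a) ≤ certificate a := by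
  have ha : a = symmMatrix (a .v0 .v1) (a .v0 .v2) (a .v1 .v2) (a .v0 .v3) (a .v1 .v3) (a .v2 .v3)
      (a .v0 .v4) (a .v1 .v4) (a .v2 .v4) (a .v3 .v4) := by
    funext i j
    cases i <;> cases j <;> first | exact hi _ | rfl | exact hs _ _
  rw [ha, ← sub_nonneg]
  apply certificate_symmMatrix <;> simp only [ht, Bool.or_self]

/-- Functions on `Five` as quintuples. -/
def fiveArrowEquiv (V : Type*) : (Five → V) ≃ V × V × V × V × V where
  toFun x := (x .v0, x .v1, x .v2, x .v3, x .v4)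
  invFun t
    | .v0 => t.1
    | .v1 => t.2.1
    | .v2 => t.2.2.1
    | .v3 => t.2.2.2.1
    | .v4 => t.2.2.2.2
  left_inv x := by funext i; cases i <;> rfl
  right_inv _ := rfl

theorem sum_five_arrow {V : Type*} [Fintype V] (g : V → V → V → V → V → ℤ) :
    ∑ x : Five → V, g (x .v0) (x .v1) (x .v2) (x .v3) (x .v4)
      = ∑ a, ∑ b, ∑ c, ∑ d, ∑ e, g a b c d e := by
  refine (Fintype.sum_equiv (fiveArrowEquiv V) _
    (fun t => g t.1 t.2.1 t.2.2.1 t.2.2.2.1 t.2.2.2.2) (fun _ => rfl)).trans ?_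
  simp only [Fintype.sum_prod_type]

theorem injective_of_nodup {V : Type*} (t : V × V × V × V × V)
    (h : [t.1, t.2.1, t.2.2.1, t.2.2.2.1, t.2.2.2.2].Nodup) :
    Function.Injective ((fiveArrowEquiv V).symm t) := by
  simp only [List.nodup_cons, List.mem_cons, List.not_mem_nil, or_false, not_or] at h
  intro i j hij
  cases i <;> cases j <;> first
    | rfl
    | (simp only [fiveArrowEquiv, Equiv.coe_fn_symm_mk] at hij; grind)

theorem sum_orderSum {V : Type*} [Fintype V] (L : List (Five × Five × Five × Five × Five))
    (hL : ∀ t ∈ L, [t.1, t.2.1, t.2.2.1, t.2.2.2.1, t.2.2.2.2].Nodup)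
    (g : V → V → V → V → V → ℤ) :
    ∑ x : Five → V, orderSum L (fun i j k l m => g (x i) (x j) (x k) (x l) (x m))
      = L.length * ∑ a, ∑ b, ∑ c, ∑ d, ∑ e, g a b c d e := by
  unfold orderSum
  induction L with
  | nil => simp
  | cons t L ih =>
    have ht : ∑ x : Five → V, g (x t.1) (x t.2.1) (x t.2.2.1) (x t.2.2.2.1) (x t.2.2.2.2)
        = ∑ a, ∑ b, ∑ c, ∑ d, ∑ e, g a b c d e := by
      rw [← sum_five_arrow]
      exact Fintype.sum_equiv (Equiv.arrowCongr (Equiv.ofBijective _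
        (Finite.injective_iff_bijective.mp (injective_of_nodup t (hL t (by simp))))).symm
        (Equiv.refl V)) _ _ (fun _ => rfl)
    simp only [List.map_cons, List.sum_cons, Finset.sum_add_distrib, List.length_cons]
    rw [ih (fun s hs => hL s (by simp [hs])), ht]
    push_cast
    ring

theorem bilin_sum {α : Type*} [Fintype α] (e p q : α → ℤ) :
    ∑ s, ∑ t, bilin (e s) (p s) (q s) (e t) (p t) (q t)
      = bilin (∑ s, e s) (∑ s, p s) (∑ s, q s) (∑ s, e s) (∑ s, p s) (∑ s, q s) := by
  simp only [bilin, Finset.sum_add_distrib, Finset.sum_sub_distrib, ← Finset.mul_sum,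
    ← Finset.sum_mul]

theorem sq_le_bilin (e p q : ℤ) : e ^ 2 ≤ bilin e p q e p q := by
  unfold bilin
  nlinarith [sq_nonneg (6 * p + q + 15 * e), sq_nonneg (479 * q - 945 * e), sq_nonneg e]

theorem sum_emptyTerm_nonneg {V : Type*} [Fintype V] (r : V → V → Bool) :
    0 ≤ ∑ a, ∑ b, ∑ c, ∑ y, ∑ z, emptyTerm r a b c y z := by
  refine Finset.sum_nonneg fun a _ => Finset.sum_nonneg fun b _ => Finset.sum_nonneg fun c _ => ?_
  unfold emptyTerm
  cases r a b || r a c || r b c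
  · simp only [cond_false, ← Finset.sum_mul_sum]
    exact mul_self_nonneg _
  · simp

theorem sum_edgePathTerm_nonneg {V : Type*} [Fintype V] (r : V → V → Bool) :
    0 ≤ ∑ a, ∑ b, ∑ c, ∑ y, ∑ z, edgePathTerm r a b c y z := by
  refine Finset.sum_nonneg fun a _ => Finset.sum_nonneg fun b _ => Finset.sum_nonneg fun c _ => ?_
  unfold edgePathTerm
  cases r a b <;> cases r a c <;> cases r b c <;>
    simp only [cond_true, cond_false, Bool.or_self, Bool.and_self, Bool.or_true, Bool.true_or,
      Bool.and_false, Bool.false_and, Finset.sum_add_distrib, ← Finset.mul_sum, ← Finset.sum_mul,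
      Finset.sum_const_zero, le_refl] <;>
    nlinarith [mul_self_nonneg (∑ y, edgeForm r a b c y), mul_self_nonneg (∑ y, diffForm r a b y)]

theorem le_sum_vertexTerm {V : Type*} [Fintype V] (r : V → V → Bool) :
    ∑ v, (10 * Fintype.card V * ∑ y, (r v y).toInt - 4 * (Fintype.card V : ℤ) ^ 2) ^ 2
      ≤ ∑ v, ∑ y, ∑ z, ∑ u, ∑ w, vertexTerm r v y z u w := by
  refine Finset.sum_le_sum fun v _ => ?_
  have h := bilin_sum (fun s : V × V => degForm r v s.1 s.2) (fun s => coedgeForm r v s.1 s.2)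
    (fun s => cherryForm r v s.1 s.2)
  have hdeg : ∑ s : V × V, degForm r v s.1 s.2
      = 10 * Fintype.card V * ∑ y, (r v y).toInt - 4 * (Fintype.card V : ℤ) ^ 2 := by
    simp only [degForm, Fintype.sum_prod_type, Finset.sum_sub_distrib, ← Finset.mul_sum,
      Finset.sum_add_distrib, Finset.sum_const, Finset.card_univ, nsmul_eq_mul,
      Fintype.card_prod]
    push_cast
    ring
  have h2 : ∑ y, ∑ z, ∑ u, ∑ w, vertexTerm r v y z u w
      = ∑ s : V × V, ∑ t : V × V, bilin (degForm r v s.1 s.2) (coedgeForm r v s.1 s.2)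
          (cherryForm r v s.1 s.2) (degForm r v t.1 t.2) (coedgeForm r v t.1 t.2)
          (cherryForm r v t.1 t.2) := by
    simp only [Fintype.sum_prod_type, vertexTerm]
  rw [h2, h, ← hdeg]
  exact sq_le_bilin _ _ _

/-- The main inequality: a triangle-free relation has at least the expected number of independent
quadruples, with a surplus bounding the induced copies of `P₄ ∪ K₁` and of `K₂ ∪ K₂`, and the
irregularity. -/
theorem indep_surplus {V : Type*} [Fintype V] (r : V → V → Bool) (hs : ∀ i j, r i j = r j i)
    (hi : ∀ i, r i i = false) (ht : ∀ i j k, (r i j && r i k && r j k) = false) :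
    625 * (∑ x : Five → V, pathPointInd (fun i j => r (x i) (x j))
        + ∑ x : Five → V, matchingInd (fun i j => r (x i) (x j)))
      + 15 * ∑ v, (10 * Fintype.card V * ∑ y, (r v y).toInt - 4 * (Fintype.card V : ℤ) ^ 2) ^ 2
      ≤ 37500 * (Fintype.card V * ∑ a, ∑ b, ∑ c, ∑ d, indepInd r a b c d)
        - 4500 * (Fintype.card V : ℤ) ^ 5 := by
  have hle := Finset.sum_le_sum fun (x : Five → V) (_ : x ∈ Finset.univ) =>
    le_certificate (fun i j => r (x i) (x j)) (fun _ _ => hs _ _) (fun _ => hi _)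
      (fun _ _ _ => ht _ _ _)
  have h1 := sum_orderSum omitOne (by simp [omitOne]) fun a b c d (_ : V) => indepInd r a b c d
  simp only [Finset.sum_const, Finset.card_univ, nsmul_eq_mul, ← Finset.mul_sum] at h1
  have h2 := sum_orderSum omitPair (by simp [omitPair]) (emptyTerm r)
  have h3 := sum_orderSum pairSinglePair (by simp [pairSinglePair]) (edgePathTerm r)
  have h4 := sum_orderSum singleMatching (by simp [singleMatching]) (vertexTerm r)
  have hcard : (Fintype.card (Five → V) : ℤ) = (Fintype.card V : ℤ) ^ 5 := by
    rw [Fintype.card_fun]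
    push_cast
    rfl
  have hsum : ∑ x : Five → V, certificate (fun i j => r (x i) (x j))
      = 7500 * (5 * (Fintype.card V * ∑ a, ∑ b, ∑ c, ∑ d, indepInd r a b c d))
        - 4500 * (Fintype.card V : ℤ) ^ 5
        - 1250 * (10 * ∑ a, ∑ b, ∑ c, ∑ y, ∑ z, emptyTerm r a b c y z)
        - 30 * ∑ a, ∑ b, ∑ c, ∑ y, ∑ z, edgePathTerm r a b c y z
        - 15 * ∑ v, ∑ y, ∑ z, ∑ u, ∑ w, vertexTerm r v y z u w := by
    have hx (x : Five → V) : certificate (fun i j => r (x i) (x j))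
        = 7500 * orderSum omitOne (fun i j k l _ => indepInd r (x i) (x j) (x k) (x l)) - 4500
          - 1250 * orderSum omitPair (fun i j k l m => emptyTerm r (x i) (x j) (x k) (x l) (x m))
          - orderSum pairSinglePair
            (fun i j k l m => edgePathTerm r (x i) (x j) (x k) (x l) (x m))
          - orderSum singleMatching
            (fun i j k l m => vertexTerm r (x i) (x j) (x k) (x l) (x m)) := rfl
    simp only [hx, Finset.sum_sub_distrib, ← Finset.mul_sum]
    rw [h1, h2, h3, h4, ← hcard, Finset.sum_const, Finset.card_univ, nsmul_eq_mul,
      mul_comm (4500 : ℤ)]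
    rfl
  rw [hsum, ← Finset.mul_sum, Finset.sum_add_distrib] at hle
  linarith [sum_emptyTerm_nonneg r, sum_edgePathTerm_nonneg r, le_sum_vertexTerm r]

open Classical in
/-- The non-adjacency relation of a graph, as a Boolean function. -/
noncomputable def nonAdj {V : Type*} (G : SimpleGraph V) (u v : V) : Bool :=
  decide (u ≠ v ∧ ¬G.Adj u v)

theorem nonAdj_eq_true {V : Type*} {G : SimpleGraph V} {u v : V} :
    nonAdj G u v = true ↔ u ≠ v ∧ ¬G.Adj u v := by
  simp [nonAdj]

theorem nonAdj_eq_false {V : Type*} {G : SimpleGraph V} {u v : V} :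
    nonAdj G u v = false ↔ u = v ∨ G.Adj u v := by
  simp [nonAdj, imp_iff_not_or]

theorem nonAdj_comm {V : Type*} (G : SimpleGraph V) (u v : V) : nonAdj G u v = nonAdj G v u := by
  rw [Bool.eq_iff_iff, nonAdj_eq_true, nonAdj_eq_true, ne_comm, G.adj_comm]

theorem nonAdj_self {V : Type*} (G : SimpleGraph V) (u : V) : nonAdj G u u = false := by
  simp [nonAdj]

theorem nonAdj_triangle {V : Type*} {G : SimpleGraph V} (hG : IndepBound G 2) (u v w : V) :
    (nonAdj G u v && nonAdj G u w && nonAdj G v w) = false := by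
  classical
  by_contra h
  simp only [Bool.not_eq_false, Bool.and_eq_true, nonAdj_eq_true] at h
  obtain ⟨⟨⟨huv, auv⟩, huw, auw⟩, hvw, avw⟩ := h
  have := hG {u, v, w} (by
    simp only [Finset.mem_insert, Finset.mem_singleton]
    rintro a (rfl | rfl | rfl) b (rfl | rfl | rfl) <;> simp_all [G.adj_comm])
  rw [Finset.card_eq_three.mpr ⟨u, v, w, huv, huw, hvw, rfl⟩] at this
  omega

theorem sum_nonAdj {n : ℕ} (G : SimpleGraph (Fin n)) (v : Fin n) :
    ∑ y, (nonAdj G v y).toInt + degCount G v + 1 = n := by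
  classical
  have h1 : (degCount G v : ℤ) = ∑ y, if G.Adj v y then 1 else 0 := by
    rw [degCount, Set.ncard_eq_toFinset_card', Finset.sum_boole]
    simp
  have h2 : (1 : ℤ) = ∑ y, if v = y then 1 else 0 := by simp
  have h3 : (n : ℤ) = ∑ _y : Fin n, 1 := by simp
  rw [h1, h2, h3, ← Finset.sum_add_distrib, ← Finset.sum_add_distrib]
  refine Finset.sum_congr rfl fun y _ => ?_
  by_cases hy : v = y
  · subst hy
    simp [nonAdj]
  · by_cases ha : G.Adj v y <;> simp [nonAdj, hy, ha]

theorem copyCount_le_card_embedding {V W : Type*} [Fintype V] [Fintype W] (H : SimpleGraph W)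
    (G : SimpleGraph V) : copyCount H G ≤ Nat.card (H ↪g G) := by
  have : Finite (H ↪g G) := DFunLike.finite _
  refine Nat.card_le_card_of_injective
    (fun s : {s : Finset V // Nonempty (H ≃g G.induce (s : Set V))} =>
      (SimpleGraph.Embedding.induce (s.1 : Set V)).comp s.2.some.toEmbedding) fun s t hst => ?_
  have hr (s : {s : Finset V // Nonempty (H ≃g G.induce (s : Set V))}) :
      Set.range ((SimpleGraph.Embedding.induce (s.1 : Set V)).comp s.2.some.toEmbedding)
        = (s.1 : Set V) := by
    ext v
    constructor
    · rintro ⟨w, rfl⟩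
      exact (s.2.some w).2
    · intro hv
      exact ⟨s.2.some.symm ⟨v, hv⟩, by
        change ((s.2.some (s.2.some.symm ⟨v, hv⟩) : (s.1 : Set V)) : V) = v
        rw [RelIso.apply_symm_apply]⟩
  apply Subtype.ext
  apply Finset.coe_injective
  rw [← hr s, ← hr t]
  exact congrArg (fun f : H ↪g G => Set.range f) hst

theorem nonAdj_embedding {V W : Type*} {H : SimpleGraph W} {G : SimpleGraph V} (f : H ↪g G)
    (i j : W) : nonAdj G (f i) (f j) = nonAdj H i j := by
  rw [Bool.eq_iff_iff, nonAdj_eq_true, nonAdj_eq_true, f.injective.ne_iff, f.map_adj_iff]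

theorem sum_eq_card_of_zero_or_one {X : Type*} [Fintype X] (g : X → ℤ)
    (hg : ∀ x, g x = 0 ∨ g x = 1) : ∑ x, g x = Nat.card {x // g x = 1} := by
  classical
  rw [Nat.card_eq_fintype_card, Fintype.card_subtype, ← Finset.sum_boole]
  refine Finset.sum_congr rfl fun x _ => ?_
  rcases hg x with h | h <;> simp [h]

theorem cond_zero_or_one (b : Bool) : (bif b then (1 : ℤ) else 0) = 0 ∨
    (bif b then (1 : ℤ) else 0) = 1 := by
  cases b <;> simp

theorem copyCount_graphG5_le {V : Type*} [Fintype V] (G : SimpleGraph V) :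
    (copyCount graphG5 G : ℤ) ≤
      ∑ x : Five → V, pathPointInd (fun i j => nonAdj G (x i) (x j)) := by
  classical
  have : Finite (graphG5 ↪g G) := DFunLike.finite _
  rw [sum_eq_card_of_zero_or_one
    (fun x : Five → V => pathPointInd (fun i j => nonAdj G (x i) (x j))) fun _ => cond_zero_or_one _]
  norm_cast
  refine (copyCount_le_card_embedding _ _).trans ?_
  refine Nat.card_le_card_of_injective (fun f => ⟨fun
    | .v0 => f 3 | .v1 => f 0 | .v2 => f 1 | .v3 => f 2 | .v4 => f 4, ?_⟩) ?_
  · simp only [pathPointInd, nonAdj_embedding]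
    simp [nonAdj, graphG5]
  · intro f g hfg
    have h := congrFun (Subtype.ext_iff.mp hfg)
    ext i
    fin_cases i
    exacts [h .v1, h .v2, h .v3, h .v0, h .v4]

theorem copyCount_cycle4_le {V : Type*} [Fintype V] (G : SimpleGraph V) :
    (copyCount cycle4 G * Fintype.card V : ℤ) ≤
      ∑ x : Five → V, matchingInd (fun i j => nonAdj G (x i) (x j)) := by
  classical
  have : Finite (cycle4 ↪g G) := DFunLike.finite _
  rw [sum_eq_card_of_zero_or_one (fun x : Five → V => matchingInd (fun i j => nonAdj G (x i) (x j)))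
    fun _ => cond_zero_or_one _, ← Nat.card_eq_fintype_card]
  norm_cast
  refine (Nat.mul_le_mul_right _ (copyCount_le_card_embedding _ _)).trans ?_
  rw [← Nat.card_prod]
  refine Nat.card_le_card_of_injective (fun p => ⟨fun
    | .v0 => p.1 0 | .v1 => p.1 2 | .v2 => p.1 1 | .v3 => p.1 3 | .v4 => p.2, ?_⟩) ?_
  · simp only [matchingInd, nonAdj_embedding]
    simp [nonAdj, cycle4]
  · rintro ⟨f, v⟩ ⟨g, w⟩ hfg
    have h := congrFun (Subtype.ext_iff.mp hfg)
    refine Prod.ext ?_ (h .v4)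
    ext i
    fin_cases i
    exacts [h .v0, h .v2, h .v1, h .v3]

theorem card_clique_tuples_le {V : Type*} [Fintype V] (G : SimpleGraph V) :
    Nat.card {x : Fin 4 → V // ∀ i j, i ≠ j → G.Adj (x i) (x j)} ≤ 24 * cliqueCount G 4 := by
  classical
  have hinj (x : {x : Fin 4 → V // ∀ i j, i ≠ j → G.Adj (x i) (x j)}) :
      Function.Injective x.1 := fun i j hij => by
    by_contra h
    exact (x.2 i j h).ne hij
  have hcard : Nat.card (Σ s : {s : Finset V // s.card = 4 ∧ G.IsClique (s : Set V)}, Fin 4 ↪ s.1)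
      = 24 * cliqueCount G 4 := by
    rw [Nat.card_eq_fintype_card, Fintype.card_sigma, Finset.sum_congr rfl (g := fun _ => 24)]
    · simp [cliqueCount, Nat.card_eq_fintype_card, mul_comm]
    · rintro ⟨s, hs, -⟩ -
      rw [Fintype.card_embedding_eq, Fintype.card_coe, hs]
      rfl
  rw [← hcard]
  refine Nat.card_le_card_of_injective (fun x => ⟨⟨Finset.univ.image x.1, ?_, ?_⟩,
    ⟨fun i => ⟨x.1 i, Finset.mem_image_of_mem _ (Finset.mem_univ i)⟩, fun i j hij =>
      hinj x (congrArg Subtype.val hij)⟩⟩) ?_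
  · rw [Finset.card_image_of_injective _ (hinj x)]
    rfl
  · rintro u hu v hv huv
    simp only [Finset.coe_image, Finset.coe_univ, Set.image_univ, Set.mem_range] at hu hv
    obtain ⟨i, rfl⟩ := hu
    obtain ⟨j, rfl⟩ := hv
    exact x.2 i j fun h => huv (by rw [h])
  · intro x y hxy
    apply Subtype.ext
    funext i
    exact congrArg (fun p : (Σ s : {s : Finset V // s.card = 4 ∧ G.IsClique (s : Set V)},
      Fin 4 ↪ s.1) => ((p.2 i : p.1.1) : V)) hxy

/-- Functions on `Fin 4` as quadruples. -/
def fourArrowEquiv (V : Type*) : (Fin 4 → V) ≃ V × V × V × V where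
  toFun x := (x 0, x 1, x 2, x 3)
  invFun t := ![t.1, t.2.1, t.2.2.1, t.2.2.2]
  left_inv x := by
    funext i
    fin_cases i <;> rfl
  right_inv _ := rfl

theorem sum_indepInd_nonAdj_le {V : Type*} [Fintype V] (G : SimpleGraph V) :
    ∑ a, ∑ b, ∑ c, ∑ d, indepInd (nonAdj G) a b c d
      ≤ 24 * cliqueCount G 4 + 6 * (Fintype.card V : ℤ) ^ 3 := by
  classical
  have hpt (a b c d : V) : indepInd (nonAdj G) a b c d
      ≤ (if ∀ i j, i ≠ j → G.Adj (![a, b, c, d] i) (![a, b, c, d] j) then 1 else 0)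
        + ((if a = b then 1 else 0) + (if a = c then 1 else 0) + (if a = d then 1 else 0)
        + (if b = c then 1 else 0) + (if b = d then 1 else 0) + (if c = d then 1 else 0)) := by
    by_cases hne : a = b ∨ a = c ∨ a = d ∨ b = c ∨ b = d ∨ c = d
    · have h1 : indepInd (nonAdj G) a b c d ≤ 1 := by
        unfold indepInd
        cases (nonAdj G a b || nonAdj G a c || nonAdj G a d || nonAdj G b c || nonAdj G b d
          || nonAdj G c d) <;> simp
      refine h1.trans ?_
      rcases hne with h | h | h | h | h | h <;> simp only [h, if_true] <;> split_ifs <;> norm_num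
    · simp only [not_or] at hne
      obtain ⟨hab, hac, had, hbc, hbd, hcd⟩ := hne
      simp only [hab, hac, had, hbc, hbd, hcd, if_false, add_zero]
      split_ifs with h
      · unfold indepInd
        cases (nonAdj G a b || nonAdj G a c || nonAdj G a d || nonAdj G b c || nonAdj G b d
          || nonAdj G c d) <;> simp
      · refine le_of_eq ?_
        unfold indepInd
        rw [cond_eq_ite, if_pos]
        by_contra hr
        simp only [Bool.or_eq_true, not_or, Bool.not_eq_true, nonAdj_eq_false, hab, hac, had, hbc,
          hbd, hcd, false_or] at hr
        obtain ⟨⟨⟨⟨⟨h1, h2⟩, h3⟩, h4⟩, h5⟩, h6⟩ := hr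
        refine h fun i j hij => ?_
        fin_cases i <;> fin_cases j <;> first
          | exact absurd rfl hij
          | assumption
          | (apply SimpleGraph.Adj.symm; assumption)
  have hclique : ∑ a, ∑ b, ∑ c, ∑ d,
      (if ∀ i j, i ≠ j → G.Adj (![a, b, c, d] i) (![a, b, c, d] j) then (1 : ℤ) else 0)
      = Nat.card {x : Fin 4 → V // ∀ i j, i ≠ j → G.Adj (x i) (x j)} := by
    rw [Nat.card_eq_fintype_card, Fintype.card_subtype, ← Finset.sum_boole]
    refine Eq.symm ((Fintype.sum_equiv (fourArrowEquiv V) _ (fun t => if ∀ i j, i ≠ j →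
      G.Adj (![t.1, t.2.1, t.2.2.1, t.2.2.2] i) (![t.1, t.2.1, t.2.2.1, t.2.2.2] j)
      then (1 : ℤ) else 0) fun x => ?_).trans ?_)
    · have hx := (fourArrowEquiv V).symm_apply_apply x
      exact congrArg (fun y : Fin 4 → V =>
        if ∀ i j, i ≠ j → G.Adj (y i) (y j) then (1 : ℤ) else 0) hx.symm
    · simp only [Fintype.sum_prod_type]
  have hc : (Nat.card {x : Fin 4 → V // ∀ i j, i ≠ j → G.Adj (x i) (x j)} : ℤ)
      ≤ 24 * cliqueCount G 4 := mod_cast card_clique_tuples_le G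
  refine (Finset.sum_le_sum fun a _ => Finset.sum_le_sum fun b _ => Finset.sum_le_sum fun c _ =>
    Finset.sum_le_sum fun d _ => hpt a b c d).trans ?_
  simp only [Finset.sum_add_distrib]
  rw [hclique]
  refine add_le_add hc (le_of_eq ?_)
  simp
  ring

/-- The surplus of 4-cliques of a graph with independence number at most 2 bounds the induced
copies of `graphG5` and `cycle4` and the deviation of the degrees from `3 n / 5`. -/
theorem clique_surplus {n : ℕ} (G : SimpleGraph (Fin n)) (hG : IndepBound G 2) :
    (625 * (copyCount graphG5 G + copyCount cycle4 G * n)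
      + 15 * ∑ v, (10 * n * ((degCount G v : ℤ) + 1) - 6 * n ^ 2) ^ 2 : ℤ)
      ≤ 37500 * (n * (24 * cliqueCount G 4 + 6 * n ^ 3)) - 4500 * n ^ 5 := by
  have h := indep_surplus (nonAdj G) (nonAdj_comm G) (nonAdj_self G) (nonAdj_triangle hG)
  have h1 := copyCount_graphG5_le G
  have h2 := copyCount_cycle4_le G
  have h3 := mul_le_mul_of_nonneg_left (sum_indepInd_nonAdj_le G) (Int.natCast_nonneg n)
  have h4 : ∑ v, (10 * n * ∑ y, (nonAdj G v y).toInt - 4 * (n : ℤ) ^ 2) ^ 2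
      = ∑ v, (10 * n * ((degCount G v : ℤ) + 1) - 6 * n ^ 2) ^ 2 := by
    refine Finset.sum_congr rfl fun v _ => ?_
    rw [show ∑ y, (nonAdj G v y).toInt = n - degCount G v - 1 by linarith [sum_nonAdj G v]]
    ring
  simp only [Fintype.card_fin] at h h2 h3
  rw [h4] at h
  linarith

/-- Stability: for every ε > 0 there are δ > 0 and n₀ such that every graph G on
n ≥ n₀ vertices with α(G) ≤ 2 and t₄(G) ≤ (3/25 + δ)·C(n,4) has at most ε·n⁵ induced
copies of G₅, at most ε·n⁴ induced copies of C₄, and all but at most ε·n vertices have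
degree within ε·n of 3n/5. -/
theorem erdos_43_stability_densities :
    ∀ ε : ℝ, 0 < ε → ∃ δ : ℝ, 0 < δ ∧ ∃ n₀ : ℕ, ∀ n : ℕ, n₀ ≤ n →
      ∀ G : SimpleGraph (Fin n), IndepBound G 2 →
        (cliqueCount G 4 : ℝ) ≤ (3/25 + δ) * (n.choose 4) →
        ((copyCount graphG5 G : ℝ) ≤ ε * (n : ℝ) ^ 5 ∧
          (copyCount cycle4 G : ℝ) ≤ ε * (n : ℝ) ^ 4 ∧
          (({v : Fin n | ¬ |(degCount G v : ℝ) - 3 * n / 5| ≤ ε * n}).ncard : ℝ)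
            ≤ ε * n) := by
  intro ε hε
  obtain ⟨δ, hδ, hδ1, hδ2⟩ : ∃ δ : ℝ, 0 < δ ∧ 120 * δ ≤ ε ∧ 200 * δ ≤ ε ^ 3 :=
    ⟨min (ε / 120) (ε ^ 3 / 200), by positivity,
      by linarith [min_le_left (ε / 120) (ε ^ 3 / 200)],
      by linarith [min_le_right (ε / 120) (ε ^ 3 / 200)]⟩
  obtain ⟨n₀, hn₀⟩ := exists_nat_ge (1 + 6 / δ + 2 / ε)
  refine ⟨δ, hδ, n₀, fun n hn G hG ht => ?_⟩
  have hN : 1 + 6 / δ + 2 / ε ≤ (n : ℝ) := hn₀.trans (mod_cast hn)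
  have hδ6 : 0 < 6 / δ := by positivity
  have hε2 : 0 < 2 / ε := by positivity
  have hn0 : (0 : ℝ) < n := by linarith
  have hnδ : 6 ≤ n * δ := (div_le_iff₀ hδ).mp (by linarith)
  have hnε : 2 ≤ n * ε := (div_le_iff₀ hε).mp (by linarith)
  have hch : 24 * (n.choose 4 : ℝ) ≤ n ^ 4 := by
    have h := Nat.choose_le_pow_div (α := ℝ) 4 n
    have h24 : ((Nat.factorial 4 : ℕ) : ℝ) = 24 := by norm_num [Nat.factorial]
    rw [h24] at h
    linarith
  have hclique : 24 * (cliqueCount G 4 : ℝ) ≤ (3 / 25 + δ) * n ^ 4 := by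
    have := mul_le_mul_of_nonneg_left hch (by positivity : 0 ≤ 3 / 25 + δ)
    linarith
  have hmain : 625 * ((copyCount graphG5 G : ℝ) + copyCount cycle4 G * n)
      + 15 * ∑ v, (10 * n * ((degCount G v : ℝ) + 1) - 6 * n ^ 2) ^ 2 ≤ 75000 * δ * n ^ 5 := by
    have h : (625 * (copyCount graphG5 G + copyCount cycle4 G * n)
        + 15 * ∑ v, (10 * n * ((degCount G v : ℝ) + 1) - 6 * n ^ 2) ^ 2 : ℝ)
        ≤ 37500 * (n * (24 * cliqueCount G 4 + 6 * n ^ 3)) - 4500 * n ^ 5 :=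
      mod_cast clique_surplus G hG
    have h1 := mul_le_mul_of_nonneg_left hclique hn0.le
    have h2 := mul_le_mul_of_nonneg_right hnδ (by positivity : (0 : ℝ) ≤ n ^ 4)
    linarith
  have hsq : 0 ≤ ∑ v, (10 * n * ((degCount G v : ℝ) + 1) - 6 * n ^ 2) ^ 2 :=
    Finset.sum_nonneg fun v _ => sq_nonneg _
  have hcyc : 0 ≤ (copyCount cycle4 G : ℝ) * n := by positivity
  have hG5 : 0 ≤ (copyCount graphG5 G : ℝ) := by positivity
  have hδn := mul_le_mul_of_nonneg_right hδ1 (by positivity : (0 : ℝ) ≤ n ^ 5)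
  refine ⟨by linarith, ?_, ?_⟩
  · refine le_of_mul_le_mul_right ?_ hn0
    linarith
  · classical
    set B := {v : Fin n | ¬ |(degCount G v : ℝ) - 3 * n / 5| ≤ ε * n} with hB
    have hbad : ∀ v ∈ B.toFinset,
        25 * ε ^ 2 * n ^ 4 ≤ (10 * n * ((degCount G v : ℝ) + 1) - 6 * n ^ 2) ^ 2 := by
      intro v hv
      rw [Set.mem_toFinset, hB, Set.mem_ofPred_eq, not_le] at hv
      have h : 5 * ε * n ≤ |10 * ((degCount G v : ℝ) - 3 * n / 5) + 10| := by
        rcases lt_abs.mp hv with h | h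
        · exact le_abs.mpr (Or.inl (by linarith))
        · exact le_abs.mpr (Or.inr (by linarith))
      calc 25 * ε ^ 2 * (n : ℝ) ^ 4 = n ^ 2 * (5 * ε * n) ^ 2 := by ring
        _ ≤ n ^ 2 * |10 * ((degCount G v : ℝ) - 3 * n / 5) + 10| ^ 2 := by gcongr
        _ = _ := by
          rw [sq_abs]
          ring
    have hcard : B.ncard * (25 * ε ^ 2 * (n : ℝ) ^ 4)
        ≤ ∑ v, (10 * n * ((degCount G v : ℝ) + 1) - 6 * n ^ 2) ^ 2 := by
      rw [Set.ncard_eq_toFinset_card', ← nsmul_eq_mul]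
      exact (Finset.card_nsmul_le_sum _ _ _ hbad).trans
        (Finset.sum_le_sum_of_subset_of_nonneg (Finset.subset_univ _) fun v _ _ => sq_nonneg _)
    have hδ3 := mul_le_mul_of_nonneg_right hδ2 (by positivity : (0 : ℝ) ≤ n ^ 5)
    refine le_of_mul_le_mul_right ?_ (by positivity : 0 < 375 * ε ^ 2 * (n : ℝ) ^ 4)
    linarith
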